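/- Let X = T^n be the n-torus and let q : T^n → T^n/T^{(n-1)} ≅ S^n collapse the (n−1)-skeleton. For any simply connected space Y, the induced map q^# : π_n(Y) → [T^n, Y] on pointed homotopy classes is injective. -/

import Mathlib

namespace TorusCollapse
open unitInterval

/-- Homotopy through maps satisfying `P`. -/
def R {X Y : Type*} [TopologicalSpace X] [TopologicalSpace Y] (P : (X → Y) → Prop)
    (f g : X → Y) : Prop :=
  ∃ Φ : I → X → Y, Continuous (Function.uncurry Φ) ∧ Φ 0 = f ∧ Φ 1 = g ∧ ∀ s, P (Φ s)

section rel
variable {X Y : Type*} [TopologicalSpace X] [TopologicalSpace Y]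

lemma R.mono {P Q : (X → Y) → Prop} {f g : X → Y} (h : R P f g) (hPQ : ∀ A, P A → Q A) :
    R Q f g := by
  obtain ⟨Φ, h1, h2, h3, h4⟩ := h
  exact ⟨Φ, h1, h2, h3, fun s => hPQ _ (h4 s)⟩

lemma R.symm {P : (X → Y) → Prop} {f g : X → Y} (h : R P f g) : R P g f := by
  obtain ⟨Φ, h1, h2, h3, h4⟩ := h
  refine ⟨fun s => Φ (unitInterval.symm s), ?_, by simpa using h3, by simpa using h2,
    fun s => h4 _⟩
  exact h1.comp (by fun_prop : Continuous fun p : I × X => (unitInterval.symm p.1, p.2))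

lemma R.trans {P : (X → Y) → Prop} {f g k : X → Y} (h : R P f g) (h' : R P g k) : R P f k := by
  obtain ⟨Φ, h1, h2, h3, h4⟩ := h
  obtain ⟨Ψ, k1, k2, k3, k4⟩ := h'
  have cf : ∀ s, Continuous (Φ s) := fun s =>
    h1.comp (by fun_prop : Continuous fun x : X => (s, x))
  have cg : ∀ s, Continuous (Ψ s) := fun s =>
    k1.comp (by fun_prop : Continuous fun x : X => (s, x))
  let H1 : ContinuousMap.HomotopyWith ⟨Φ 0, cf 0⟩ ⟨Φ 1, cf 1⟩ (fun A : C(X, Y) => P A) :=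
    { toFun := Function.uncurry Φ
      continuous_toFun := h1
      map_zero_left := fun x => rfl
      map_one_left := fun x => rfl
      prop' := fun t => h4 t }
  let H2 : ContinuousMap.HomotopyWith ⟨Φ 1, cf 1⟩ ⟨Ψ 1, cg 1⟩ (fun A : C(X, Y) => P A) :=
    { toFun := Function.uncurry Ψ
      continuous_toFun := k1
      map_zero_left := fun x => by
        change Ψ 0 x = Φ 1 x
        rw [h3, k2]
      map_one_left := fun x => rfl
      prop' := fun t => k4 t }
  let H := H1.trans H2
  refine ⟨fun s x => H (s, x), H.continuous, ?_, ?_, fun s => H.prop s⟩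
  · funext x
    have := H.apply_zero x
    rw [← h2]; exact this
  · funext x
    have := H.apply_one x
    rw [← k3]; exact this

open Classical in
/-- Two maps, one of which is trivial at each point, combined. -/
noncomputable def glue (y₀ : Y) (g k : X → Y) (x : X) : Y := if g x = y₀ then k x else g x

lemma glue_cont {y₀ : Y} {g k : X → Y} (hg : Continuous g) (hk : Continuous k)
    (S T : Set X) (hS : IsClosed S) (hT : IsClosed T) (hST : ∀ x, x ∈ S ∨ x ∈ T)
    (kS : ∀ x ∈ S, k x = y₀) (gT : ∀ x ∈ T, g x = y₀) : Continuous (glue y₀ g k) := by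
  have e1 : ∀ x ∈ S, glue y₀ g k x = g x := by
    intro x hx
    unfold glue
    split_ifs with h
    · rw [kS x hx, h]
    · rfl
  have e2 : ∀ x ∈ T, glue y₀ g k x = k x := by
    intro x hx
    unfold glue
    rw [if_pos (gT x hx)]
  rw [← continuousOn_univ]
  have : (Set.univ : Set X) = S ∪ T := by
    ext x; simpa using hST x
  rw [this]
  exact (hg.continuousOn.congr e1).union_of_isClosed (hk.continuousOn.congr e2) hS hT

end rel

/-- clamp -/
noncomputable def cl (x : ℝ) : I := Set.projIcc 0 1 zero_le_one x

lemma cl_cont : Continuous cl := continuous_projIcc (h := zero_le_one)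
lemma cl_le {x : ℝ} (h : x ≤ 0) : cl x = 0 := Set.projIcc_of_le_left _ h
lemma cl_ge {x : ℝ} (h : 1 ≤ x) : cl x = 1 := Set.projIcc_of_right_le _ h
lemma cl_coe (x : I) : cl (x : ℝ) = x := Set.projIcc_val _ x

noncomputable def cc (x : I) : I := cl (3 * (x : ℝ))
noncomputable def ph (x : I) : I := cl ((3 * (x : ℝ) - 1) / 2)
noncomputable def rh (x : I) : I := cl (3 * (x : ℝ) - 1)
noncomputable def mm (x : I) : I := cl (min (3 * (x : ℝ)) (3 - 3 * (x : ℝ)))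
noncomputable def interp (v a b : I) : I := cl ((1 - (v : ℝ)) * a + v * b)

lemma cc_cont : Continuous cc := cl_cont.comp (by fun_prop)
lemma ph_cont : Continuous ph := cl_cont.comp (by fun_prop)
lemma rh_cont : Continuous rh := cl_cont.comp (by fun_prop)
lemma mm_cont : Continuous mm := cl_cont.comp (by fun_prop)
lemma interp_cont : Continuous fun p : I × I × I => interp p.1 p.2.1 p.2.2 :=
  cl_cont.comp (by fun_prop)

def En (a : I) : Prop := a = 0 ∨ a = 1
def Eq' (a b : I) : Prop := a = b ∨ (En a ∧ En b)

lemma interp_zero (a b : I) : interp 0 a b = a := by simp [interp, cl_coe]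
lemma interp_one (a b : I) : interp 1 a b = b := by simp [interp, cl_coe]
lemma interp_same (v a : I) : interp v a a = a := by
  have : (1 - (v : ℝ)) * a + v * a = a := by ring
  simp [interp, this, cl_coe]

lemma cc_zero : cc 0 = 0 := cl_le (by simp)
lemma cc_one : cc 1 = 1 := cl_ge (by norm_num)
lemma ph_zero : ph 0 = 0 := cl_le (by norm_num)
lemma ph_one : ph 1 = 1 := cl_ge (by norm_num)
lemma rh_zero : rh 0 = 0 := cl_le (by norm_num)
lemma rh_one : rh 1 = 1 := cl_ge (by norm_num)
lemma mm_zero : mm 0 = 0 := cl_le (by simp)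
lemma mm_one : mm 1 = 0 := cl_le (by simp)
lemma cc_third {x : I} (h : 1 / 3 ≤ (x : ℝ)) : cc x = 1 := cl_ge (by linarith)
lemma ph_third {x : I} (h : (x : ℝ) ≤ 1 / 3) : ph x = 0 := cl_le (by linarith)
lemma rh_third {x : I} (h : (x : ℝ) ≤ 1 / 3) : rh x = 0 := cl_le (by linarith)
lemma rh_third' {x : I} (h : 2 / 3 ≤ (x : ℝ)) : rh x = 1 := cl_ge (by linarith)
lemma mm_mid {x : I} (h : 1 / 3 ≤ (x : ℝ)) (h' : (x : ℝ) ≤ 2 / 3) : mm x = 1 :=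
  cl_ge (le_min (by linarith) (by linarith))
lemma mm_end {x : I} (h : En x) : mm x = 0 := by
  rcases h with rfl | rfl
  exacts [mm_zero, mm_one]

/-- preserves the end points -/
def Pres (α : I → I) : Prop := α 0 = 0 ∧ α 1 = 1

lemma Pres.en {α : I → I} (h : Pres α) {a : I} (ha : En a) : En (α a) := by
  rcases ha with rfl | rfl
  exacts [Or.inl h.1, Or.inr h.2]
lemma Pres.eq' {α : I → I} (h : Pres α) {a b : I} (ha : Eq' a b) : Eq' (α a) (α b) := by
  rcases ha with rfl | ⟨h1, h2⟩
  exacts [Or.inl rfl, Or.inr ⟨h.en h1, h.en h2⟩]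

section cube
set_option linter.unusedSectionVars false
variable {ι : Type*} {Y : Type*} [TopologicalSpace Y]

def Bd (y₀ : Y) (A : (ι → I) → Y) : Prop := ∀ t j, En (t j) → A t = y₀

structure CS (S : Set ι) (y₀ : Y) (A : (ι → I) → Y) : Prop where
  bd : ∀ t, ∀ j ∈ S, En (t j) → A t = y₀
  per : ∀ t t', (∀ j, Eq' (t j) (t' j)) → A t = A t'
  vert : ∀ t, (∀ j, En (t j)) → A t = y₀

lemma Bd.cs (i : ι) (S : Set ι) {y₀ : Y} {A : (ι → I) → Y} (h : Bd y₀ A) : CS S y₀ A where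
  bd := fun t j _ hj => h t j hj
  per := by
    intro t t' H
    by_cases hh : ∃ j, En (t j) ∧ En (t' j)
    · obtain ⟨j, h1, h2⟩ := hh
      rw [h t j h1, h t' j h2]
    · push Not at hh
      congr 1
      funext j
      rcases H j with h1 | ⟨h1, h2⟩
      · exact h1
      · exact absurd h2 (hh j h1)
  vert := fun t H => h t i (H i)

lemma rep {y₀ : Y} {F : (ι → I) → Y} (hF : Continuous F) (bF : Bd y₀ F) (α β : ι → I → I)
    (cα : ∀ j, Continuous (α j)) (cβ : ∀ j, Continuous (β j))
    (pα : ∀ j, Pres (α j)) (pβ : ∀ j, Pres (β j)) :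
    R (Bd y₀) (fun t => F (fun j => α j (t j))) (fun t => F (fun j => β j (t j))) := by
  refine ⟨fun s t => F (fun j => interp s (α j (t j)) (β j (t j))), ?_, ?_, ?_, ?_⟩
  · refine hF.comp (continuous_pi fun j => ?_)
    have := cα j
    have := cβ j
    exact interp_cont.comp (by fun_prop :
      Continuous fun p : I × (ι → I) => (p.1, α j (p.2 j), β j (p.2 j)))
  · simp [interp_zero]
  · simp [interp_one]
  · intro s t j hj
    refine bF _ j ?_
    rcases hj with h | h
    · left; simp [h, (pα j).1, (pβ j).1, interp_same]
    · right; simp [h, (pα j).2, (pβ j).2, interp_same]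

open Classical in
lemma step [Finite ι] {y₀ : Y} {F G : (ι → I) → Y} (hF : Continuous F) (hG : Continuous G)
    (bF : Bd y₀ F) (bG : Bd y₀ G) (S : Set ι) (i : ι) (h : R (CS S y₀) F G) :
    R (CS (insert i S) y₀) F G := by
  obtain ⟨K, hK, K0, K1, KP⟩ := h
  have K0' : ∀ t, K 0 t = F t := fun t => by rw [K0]
  have K1' : ∀ t, K 1 t = G t := fun t => by rw [K1]
  let β : ι → I → I := fun j => if j = i then rh else cc
  let γ : ι → I → I := fun j => if j = i then rh else ph
  have βi : β i = rh := by simp [β]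
  have γi : γ i = rh := by simp [γ]
  have βj : ∀ j, j ≠ i → β j = cc := fun j hj => by simp [β, hj]
  have γj : ∀ j, j ≠ i → γ j = ph := fun j hj => by simp [γ, hj]
  have cβ : ∀ j, Continuous (β j) := fun j => by
    by_cases hj : j = i
    · rw [hj, βi]; exact rh_cont
    · rw [βj j hj]; exact cc_cont
  have cγ : ∀ j, Continuous (γ j) := fun j => by
    by_cases hj : j = i
    · rw [hj, γi]; exact rh_cont
    · rw [γj j hj]; exact ph_cont
  have pβ : ∀ j, Pres (β j) := fun j => by
    by_cases hj : j = i
    · rw [hj, βi]; exact ⟨rh_zero, rh_one⟩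
    · rw [βj j hj]; exact ⟨cc_zero, cc_one⟩
  have pγ : ∀ j, Pres (γ j) := fun j => by
    by_cases hj : j = i
    · rw [hj, γi]; exact ⟨rh_zero, rh_one⟩
    · rw [γj j hj]; exact ⟨ph_zero, ph_one⟩
  -- the restriction of K to the i-th face
  let a : (ι → I) → ι → I := fun t j => if j = i then 0 else cc (t j)
  have ai : ∀ t, a t i = 0 := fun t => by simp [a]
  have aj : ∀ t j, j ≠ i → a t j = cc (t j) := fun t j hj => by simp [a, hj]
  have ca : Continuous a := continuous_pi fun j => by
    by_cases hj : j = i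
    · simp only [a, hj, if_true]; fun_prop
    · simp only [a, hj, if_false]; exact cc_cont.comp (continuous_apply j)
  let κ : (ι → I) → I → Y := fun t s => K s (a t)
  have cκ : Continuous fun p : (ι → I) × I => κ p.1 p.2 :=
    hK.comp (by fun_prop : Continuous fun p : (ι → I) × I => (p.2, a p.1))
  have κ0 : ∀ t, κ t 0 = y₀ := fun t => by
    change K 0 _ = _
    rw [K0']; exact bF _ i (Or.inl (ai t))
  have κ1 : ∀ t, κ t 1 = y₀ := fun t => by
    change K 1 _ = _
    rw [K1']; exact bG _ i (Or.inl (ai t))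
  have κS : ∀ t s, ∀ j ∈ S, En (t j) → κ t s = y₀ := by
    intro t s j hj he
    refine (KP s).bd _ j hj ?_
    by_cases h : j = i
    · subst h; left; exact ai t
    · rw [aj t j h]; exact Pres.en ⟨cc_zero, cc_one⟩ he
  have κper : ∀ t t' s, (∀ j, Eq' (t j) (t' j)) → κ t s = κ t' s := by
    intro t t' s H
    refine (KP s).per _ _ fun j => ?_
    by_cases h : j = i
    · subst h; left; rw [ai, ai]
    · rw [aj t j h, aj t' j h]; exact Pres.eq' ⟨cc_zero, cc_one⟩ (H j)
  have κvert : ∀ t s, (∀ j, j ≠ i → En (cc (t j))) → κ t s = y₀ := by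
    intro t s H
    refine (KP s).vert _ fun j => ?_
    by_cases h : j = i
    · subst h; left; exact ai t
    · rw [aj t j h]; exact H j h
  -- κ can also be read off when the i-th coordinate is at an end
  have κend : ∀ t s, En (rh (t i)) → K s (fun j => β j (t j)) = κ t s := by
    intro t s H
    refine (KP s).per _ _ fun j => ?_
    by_cases h : j = i
    · subst h
      right; rw [ai, βi]; exact ⟨H, Or.inl rfl⟩
    · left; rw [aj t j h, βj j h]
  -- membership of glued maps
  have glueP : ∀ (A : (ι → I) → Y) (w : I → I), Bd y₀ A → w 0 = 0 → w 1 = 0 →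
      CS (insert i S) y₀ (glue y₀ A fun t => κ t (w (t i))) := by
    intro A w hA w0 w1
    have wE : ∀ x, En x → w x = 0 := by
      rintro x (rfl | rfl)
      exacts [w0, w1]
    have wE' : ∀ x x', Eq' x x' → w x = w x' := by
      rintro x x' (rfl | ⟨h1, h2⟩)
      · rfl
      · rw [wE _ h1, wE _ h2]
    refine ⟨?_, ?_, ?_⟩
    · intro t j hj he
      unfold glue
      rw [if_pos (hA t j he)]
      rcases hj with rfl | hj
      · simp only [wE _ he, κ0]
      · exact κS t _ j hj he
    · intro t t' H
      have e1 : A t = A t' := (hA.cs i S).per t t' H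
      unfold glue
      simp only [e1, wE' _ _ (H i), κper t t' _ H]
    · intro t H
      unfold glue
      rw [if_pos (hA t i (H i))]
      simp only [wE _ (H i), κ0]
  -- step 0
  have s0 : R (CS (insert i S) y₀) F (fun t => F (fun j => β j (t j))) :=
    (rep hF bF (fun _ x => x) β (fun _ => continuous_id) cβ (fun _ => ⟨rfl, rfl⟩) pβ).mono
      fun A hA => hA.cs i _
  -- step 1
  have s1 : R (CS (insert i S) y₀) (fun t => F (fun j => β j (t j)))
      (fun t => K (mm (t i)) (fun j => β j (t j))) := by
    refine ⟨fun s t => K (min s (mm (t i))) (fun j => β j (t j)), ?_, ?_, ?_, ?_⟩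
    · have := mm_cont
      exact hK.comp (by fun_prop : Continuous fun p : I × (ι → I) =>
        (min p.1 (mm (p.2 i)), fun j => β j (p.2 j)))
    · funext t
      simp only [min_eq_left (unitInterval.nonneg' (t := mm (t i))), K0]
    · funext t
      simp only [min_eq_right (unitInterval.le_one' (t := mm (t i)))]
    · intro s
      refine ⟨?_, ?_, ?_⟩
      · intro t j hj he
        by_cases h : j = i
        · subst h
          change K (min s (mm (t j))) _ = _
          rw [mm_end he, min_eq_right unitInterval.nonneg', K0']
          exact bF _ j ((pβ j).en he)
        · exact (KP _).bd _ j (hj.resolve_left h) ((pβ j).en he)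
      · intro t t' H
        have : mm (t i) = mm (t' i) := by
          rcases H i with h | ⟨h1, h2⟩
          · rw [h]
          · rw [mm_end h1, mm_end h2]
        change K (min s (mm (t i))) _ = K (min s (mm (t' i))) _
        rw [this]
        exact (KP _).per _ _ fun j => (pβ j).eq' (H j)
      · intro t H
        exact (KP _).vert _ fun j => (pβ j).en (H j)
  -- step 2
  have e2 : (fun t => K (mm (t i)) (fun j => β j (t j))) =
      glue y₀ (fun t => G (fun j => β j (t j))) (fun t => κ t (mm (t i))) := by
    funext t
    unfold glue
    by_cases h : En (rh (t i))
    · rw [if_pos (bG _ i (by rw [βi]; exact h))]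
      exact κend t _ h
    · have h1 : 1 / 3 ≤ (t i : ℝ) := by
        by_contra hc
        exact h (Or.inl (rh_third (by linarith)))
      have h2 : (t i : ℝ) ≤ 2 / 3 := by
        by_contra hc
        exact h (Or.inr (rh_third' (by linarith)))
      simp only [mm_mid h1 h2, K1', κ1]
      split_ifs with h3
      · exact h3
      · rfl
  have s2 : R (CS (insert i S) y₀)
      (glue y₀ (fun t => G (fun j => β j (t j))) (fun t => κ t (mm (t i))))
      (glue y₀ (fun t => G (fun j => γ j (t j))) (fun t => κ t (mm (t i)))) := by
    let Ψ : I → (ι → I) → Y := fun s t => G (fun j => interp s (β j (t j)) (γ j (t j)))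
    have cΨ : Continuous (Function.uncurry Ψ) := by
      refine hG.comp (continuous_pi fun j => ?_)
      have := cβ j
      have := cγ j
      exact interp_cont.comp (by fun_prop :
        Continuous fun p : I × (ι → I) => (p.1, β j (p.2 j), γ j (p.2 j)))
    refine ⟨fun s => glue y₀ (Ψ s) (fun t => κ t (mm (t i))), ?_, ?_, ?_, ?_⟩
    · have hc := glue_cont (y₀ := y₀) (g := Function.uncurry Ψ)
        (k := fun p : I × (ι → I) => κ p.2 (mm (p.2 i))) cΨ
        (cκ.comp (by have := mm_cont; fun_prop :
          Continuous fun p : I × (ι → I) => (p.2, mm (p.2 i))))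
        ({p | 1 / 3 ≤ (p.2 i : ℝ)} ∩ {p | (p.2 i : ℝ) ≤ 2 / 3})
        ({p | (p.2 i : ℝ) ≤ 1 / 3} ∪ {p | 2 / 3 ≤ (p.2 i : ℝ)})
        ((isClosed_le (by fun_prop) (by fun_prop)).inter
          (isClosed_le (by fun_prop) (by fun_prop)))
        ((isClosed_le (by fun_prop) (by fun_prop)).union
          (isClosed_le (by fun_prop) (by fun_prop)))
        (by
          intro p
          by_cases h1 : (p.2 i : ℝ) ≤ 1 / 3
          · exact Or.inr (Or.inl h1)
          · by_cases h2 : 2 / 3 ≤ (p.2 i : ℝ)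
            · exact Or.inr (Or.inr h2)
            · exact Or.inl ⟨(not_le.1 h1).le, (not_le.1 h2).le⟩)
        (by
          rintro p ⟨h1, h2⟩
          change κ p.2 (mm (p.2 i)) = y₀
          rw [mm_mid h1 h2, κ1])
        (by
          rintro p (h1 | h1)
          · refine bG _ i (Or.inl ?_)
            rw [βi, γi, rh_third h1, interp_same]
          · refine bG _ i (Or.inr ?_)
            rw [βi, γi, rh_third' h1, interp_same])
      exact hc
    · simp [Ψ, interp_zero]
    · simp [Ψ, interp_one]
    · intro s
      refine glueP _ _ ?_ mm_zero mm_one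
      intro t j hj
      refine bG _ j ?_
      rcases hj with h | h
      · left; simp [h, (pβ j).1, (pγ j).1, interp_same]
      · right; simp [h, (pβ j).2, (pγ j).2, interp_same]
  -- step 3
  have bGγ : Bd y₀ (fun t => G (fun j => γ j (t j))) := fun t j hj => bG _ j ((pγ j).en hj)
  have cGγ : Continuous (fun t : ι → I => G (fun j => γ j (t j))) :=
    hG.comp (continuous_pi fun j => (cγ j).comp (continuous_apply j))
  have s3 : R (CS (insert i S) y₀)
      (fun t => G (fun j => γ j (t j)))
      (glue y₀ (fun t => G (fun j => γ j (t j))) (fun t => κ t (mm (t i)))) := by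
    refine ⟨fun v => glue y₀ (fun t => G (fun j => γ j (t j)))
      (fun t => κ t (v * (mm (t i)))), ?_, ?_, ?_, ?_⟩
    · have hc := glue_cont (y₀ := y₀) (g := fun p : I × (ι → I) => G (fun j => γ j (p.2 j)))
        (k := fun p : I × (ι → I) => κ p.2 (p.1 * mm (p.2 i))) (cGγ.comp continuous_snd)
        (cκ.comp (by have := mm_cont; fun_prop :
          Continuous fun p : I × (ι → I) => (p.2, p.1 * mm (p.2 i))))
        (⋂ j : {j // j ≠ i}, {p | 1 / 3 ≤ (p.2 j.1 : ℝ)})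
        (⋃ j : {j // j ≠ i}, {p | (p.2 j.1 : ℝ) ≤ 1 / 3})
        (isClosed_iInter fun j => isClosed_le (by fun_prop) (by fun_prop))
        (isClosed_iUnion_of_finite fun j => isClosed_le (by fun_prop) (by fun_prop))
        (by
          intro p
          by_cases h : ∃ j : {j // j ≠ i}, (p.2 j.1 : ℝ) ≤ 1 / 3
          · exact Or.inr (Set.mem_iUnion.2 h)
          · push Not at h
            exact Or.inl (Set.mem_iInter.2 fun j => (h j).le))
        (by
          intro p hp
          rw [Set.mem_iInter] at hp
          exact κvert _ _ fun j hj => Or.inr (cc_third (hp ⟨j, hj⟩)))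
        (by
          intro p hp
          obtain ⟨j, hj⟩ := Set.mem_iUnion.1 hp
          refine bG _ j.1 (Or.inl ?_)
          rw [γj j.1 j.2, ph_third hj])
      exact hc
    · funext t
      simp [glue, κ0]
      exact fun h => h.symm
    · simp
    · intro s
      exact glueP _ (fun x => s * mm x) bGγ (by simp [mm_zero]) (by simp [mm_one])
  have s4 : R (CS (insert i S) y₀) G (fun t => G (fun j => γ j (t j))) :=
    (rep hG bG (fun _ x => x) γ (fun _ => continuous_id) cγ (fun _ => ⟨rfl, rfl⟩) pγ).mono
      fun A hA => hA.cs i _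
  rw [e2] at s1
  exact s0.trans (s1.trans (s2.trans (s3.symm.trans s4.symm)))

lemma main [Finite ι] {y₀ : Y} {F G : (ι → I) → Y} (hF : Continuous F) (hG : Continuous G)
    (bF : Bd y₀ F) (bG : Bd y₀ G) (h : R (CS ∅ y₀) F G) : R (Bd y₀) F G := by
  have : ∀ S : Set ι, R (CS S y₀) F G := by
    intro S
    induction S, S.toFinite using Set.Finite.induction_on with
    | empty => exact h
    | insert _ _ ih => exact step hF hG bF bG _ _ ih
  exact (this Set.univ).mono fun A hA t j hj => hA.bd t j trivial hj

lemma extra [Fintype ι] [SimplyConnectedSpace Y] {y₀ : Y} {F G : (ι → I) → Y}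
    (hF : Continuous F) (hG : Continuous G) (bF : Bd y₀ F) (bG : Bd y₀ G) (x₀ : ι → I)
    (hx : ∀ j, ¬ En (x₀ j)) (Fx : F x₀ = y₀) (Gx : G x₀ = y₀) (h : R (Bd y₀) F G) :
    R (fun A => Bd y₀ A ∧ A x₀ = y₀) F G := by
  obtain ⟨L, hL, L0, L1, LP⟩ := h
  have hpos : ∀ j, 0 < (x₀ j : ℝ) := fun j =>
    lt_of_le_of_ne (x₀ j).2.1 fun h => hx j (Or.inl (Subtype.ext h.symm))
  have hlt : ∀ j, (x₀ j : ℝ) < 1 := fun j =>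
    lt_of_le_of_ne (x₀ j).2.2 fun h => hx j (Or.inr (Subtype.ext h))
  have hε : ∀ j, ∃ ε : ℝ, 0 < ε ∧ 2 * ε ≤ x₀ j ∧ 2 * ε ≤ 1 - x₀ j := fun j =>
    ⟨min (x₀ j : ℝ) (1 - x₀ j) / 2,
      by have := lt_min (hpos j) (sub_pos.2 (hlt j)); linarith,
      by have := min_le_left (x₀ j : ℝ) (1 - x₀ j); linarith,
      by have := min_le_right (x₀ j : ℝ) (1 - x₀ j); linarith⟩
  choose ε ε0 ε1 ε2 using hε
  let v : ι → I → ℝ := fun j t => ((t : ℝ) - x₀ j) / ε j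
  have cv : ∀ j, Continuous (v j) := fun j => by fun_prop
  have vx : ∀ j, v j (x₀ j) = 0 := fun j => by simp [v]
  have vε : ∀ j t, ε j * v j t = (t : ℝ) - x₀ j := fun j t => by
    have := (ε0 j).ne'
    simp only [v]; field_simp
  let r : ι → I → I := fun j t =>
    cl ((x₀ j : ℝ) + 2 * ε j * (v j t - max (-1) (min 1 (v j t))))
  have cr : ∀ j, Continuous (r j) := fun j => by
    have := cv j
    exact cl_cont.comp (by fun_prop)
  have rbox : ∀ j t, |v j t| ≤ 1 → r j t = x₀ j := by
    intro j t ht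
    rw [abs_le] at ht
    simp only [r]
    rw [min_eq_right ht.2, max_eq_right ht.1]
    simp [cl_coe]
  have pr : ∀ j, Pres (r j) := by
    intro j
    constructor
    · refine cl_le ?_
      have h1 := vε j 0
      have h2 : max (-1) (min 1 (v j 0)) ≥ -1 := le_max_left _ _
      have h3 := mul_le_mul_of_nonneg_left h2 (ε0 j).le
      have h4 := ε1 j
      have h5 : ((0 : I) : ℝ) = 0 := rfl
      rw [h5] at h1
      nlinarith
    · refine cl_ge ?_
      have h1 := vε j 1
      have h2 : max (-1) (min 1 (v j 1)) ≤ 1 := max_le (by norm_num) (min_le_left _ _)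
      have h3 := mul_le_mul_of_nonneg_left h2 (ε0 j).le
      have h4 := ε2 j
      have h5 : ((1 : I) : ℝ) = 1 := rfl
      rw [h5] at h1
      nlinarith
  have rx : ∀ j, r j (x₀ j) = x₀ j := fun j => rbox j _ (by rw [vx]; simp)
  -- reparametrization
  have rp : ∀ A : (ι → I) → Y, Continuous A → Bd y₀ A → A x₀ = y₀ →
      R (fun A => Bd y₀ A ∧ A x₀ = y₀) A (fun t => A (fun j => r j (t j))) := by
    intro A cA bA Ax
    refine ⟨fun s t => A (fun j => interp s (t j) (r j (t j))), ?_, ?_, ?_, ?_⟩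
    · refine cA.comp (continuous_pi fun j => ?_)
      have := cr j
      exact interp_cont.comp (by fun_prop :
        Continuous fun p : I × (ι → I) => (p.1, p.2 j, r j (p.2 j)))
    · simp [interp_zero]
    · simp [interp_one]
    · intro s
      constructor
      · intro t j hj
        refine bA _ j ?_
        rcases hj with h | h
        · left; simp [h, (pr j).1, interp_same]
        · right; simp [h, (pr j).2, interp_same]
      · simp only [rx, interp_same, Ax]
  -- the loop at the extra point
  let lam : Path y₀ y₀ :=
    { toFun := fun s => L s x₀
      continuous_toFun := hL.comp (by fun_prop : Continuous fun s : I => (s, x₀))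
      source' := by
        change L 0 x₀ = y₀
        rw [L0, Fx]
      target' := by
        change L 1 x₀ = y₀
        rw [L1, Gx] }
  obtain ⟨N⟩ := SimplyConnectedSpace.paths_homotopic (Path.refl y₀) lam
  have N0 : ∀ s, N (0, s) = y₀ := fun s => by simp
  have N1 : ∀ s, N (1, s) = L s x₀ := fun s => by
    rw [N.apply_one]; rfl
  have Ns : ∀ w, N (w, 0) = y₀ := fun w => by simp
  have Nt : ∀ w, N (w, 1) = y₀ := fun w => by simp
  let V : (ι → I) → ι → ℝ := fun t j => v j (t j)
  have cV : Continuous V := continuous_pi fun j => (cv j).comp (continuous_apply j)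
  have Vbox : ∀ t, ‖V t‖ ≤ 1 → (fun j => r j (t j)) = x₀ := by
    intro t ht
    funext j
    exact rbox j _ ((norm_le_pi_norm (V t) j).trans ht)
  have Vend : ∀ t j, En (t j) → ¬ ‖V t‖ ≤ 1 := by
    intro t j hj ht
    have := congrFun (Vbox t ht) j
    refine hx j ?_
    rw [← this]
    exact (pr j).en hj
  have mid : R (fun A => Bd y₀ A ∧ A x₀ = y₀) (fun t => F (fun j => r j (t j)))
      (fun t => G (fun j => r j (t j))) := by
    classical
    refine ⟨fun s t => if ‖V t‖ ≤ 1 then N (cl ‖V t‖, s) else L s (fun j => r j (t j)),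
      ?_, ?_, ?_, ?_⟩
    · have hc : Continuous fun p : I × (ι → I) =>
          if ‖V p.2‖ ≤ 1 then N (cl ‖V p.2‖, p.1) else L p.1 (fun j => r j (p.2 j)) := by
        refine Continuous.if_le ?_ ?_ (by fun_prop) continuous_const ?_
        · have := cl_cont
          exact N.continuous.comp (by fun_prop)
        · exact hL.comp (by fun_prop :
            Continuous fun p : I × (ι → I) => (p.1, fun j => r j (p.2 j)))
        · intro p hp
          rw [Vbox _ hp.le, hp, cl_ge le_rfl, N1]
      exact hc
    · funext t
      by_cases ht : ‖V t‖ ≤ 1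
      · simp only [ht, if_true, Ns, Vbox t ht, Fx]
      · simp only [ht, if_false, L0]
    · funext t
      by_cases ht : ‖V t‖ ≤ 1
      · simp only [ht, if_true, Nt, Vbox t ht, Gx]
      · simp only [ht, if_false, L1]
    · intro s
      constructor
      · intro t j hj
        simp only [Vend t j hj, if_false]
        exact LP s _ j ((pr j).en hj)
      · have : V x₀ = 0 := funext fun j => vx j
        simp only [this, norm_zero, zero_le_one, if_true, cl_le le_rfl, N0]
  exact (rp F hF bF Fx).trans (mid.trans (rp G hG bG Gx).symm)

end cube

/-- The parametrization of the circle. -/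
noncomputable def ee (t : I) : Circle := Circle.exp (2 * Real.pi * t)

lemma ee_cont : Continuous ee := Circle.exp.continuous.comp (by fun_prop)

lemma ee_zero : ee 0 = 1 := by simp [ee]
lemma ee_one : ee 1 = 1 := by simp [ee]

lemma ee_en {a : I} (h : En a) : ee a = 1 := by
  rcases h with rfl | rfl
  exacts [ee_zero, ee_one]

lemma ee_eq' {a b : I} (h : Eq' a b) : ee a = ee b := by
  rcases h with rfl | ⟨h1, h2⟩
  · rfl
  · rw [ee_en h1, ee_en h2]

lemma ee_inj {a b : I} (h : ee a = ee b) : Eq' a b := by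
  obtain ⟨m, hm⟩ := Circle.exp_eq_exp.1 h
  have hm' : (a : ℝ) = b + m := by
    have := Real.pi_pos
    have h2 : (2 * Real.pi) * (a : ℝ) = (2 * Real.pi) * (b + m) := by rw [hm]; ring
    exact mul_left_cancel₀ (by positivity) h2
  have ha := a.2
  have hb := b.2
  have h1 : (m : ℝ) ≤ 1 := by linarith [ha.2, hb.1]
  have h2 : (-1 : ℝ) ≤ m := by linarith [ha.1, hb.2]
  have h1' : m ≤ 1 := by exact_mod_cast h1
  have h2' : -1 ≤ m := by exact_mod_cast h2
  have : m = -1 ∨ m = 0 ∨ m = 1 := by omega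
  rcases this with rfl | rfl | rfl
  · right
    push_cast at hm'
    exact ⟨Or.inl (Subtype.ext (by change (a : ℝ) = 0; linarith [ha.1, hb.2])),
      Or.inr (Subtype.ext (by change (b : ℝ) = 1; linarith [ha.1, hb.2]))⟩
  · left
    exact Subtype.ext (by simpa using hm')
  · right
    push_cast at hm'
    exact ⟨Or.inr (Subtype.ext (by change (a : ℝ) = 1; linarith [ha.2, hb.1])),
      Or.inl (Subtype.ext (by change (b : ℝ) = 0; linarith [ha.2, hb.1]))⟩

lemma ee_one_en {a : I} (h : ee a = 1) : En a := by
  rcases ee_inj (h.trans ee_zero.symm) with h | h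
  · exact Or.inl h
  · exact h.1

lemma ee_surj (z : Circle) : ∃ a : I, ee a = z := by
  have hp := Real.pi_pos
  have h1 := Complex.neg_pi_lt_arg (z : ℂ)
  have h2 := Complex.arg_le_pi (z : ℂ)
  by_cases h : 0 ≤ Complex.arg (z : ℂ)
  · refine ⟨⟨Complex.arg z / (2 * Real.pi), by positivity, ?_⟩, ?_⟩
    · rw [div_le_one (by positivity)]; linarith
    · have : 2 * Real.pi * (Complex.arg z / (2 * Real.pi)) = Complex.arg z := by field_simp
      simp only [ee, this]
      exact Circle.exp_arg z
  · push Not at h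
    refine ⟨⟨(Complex.arg z + 2 * Real.pi) / (2 * Real.pi), ?_, ?_⟩, ?_⟩
    · apply div_nonneg <;> linarith
    · rw [div_le_one (by positivity)]; linarith
    · have : 2 * Real.pi * ((Complex.arg z + 2 * Real.pi) / (2 * Real.pi))
          = Complex.arg z + 2 * Real.pi := by field_simp
      simp only [ee, this]
      rw [Circle.exp_add, Circle.exp_two_pi, mul_one]
      exact Circle.exp_arg z

end TorusCollapse


/-- Injectivity of `q^# : π_n(Y) → [T^n, Y]` for simply connected `Y`, where
`q : T^n → T^n/T^{(n-1)} ≅ S^n` collapses the `(n-1)`-skeleton of the torus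
(the set of points with some coordinate at the basepoint).  `q` is presented as
a quotient map to `S^n` collapsing exactly the skeleton; injectivity of the
induced map on pointed homotopy classes says: if two pointed maps `f g : S^n → Y`
become homotopic rel basepoint after composing with `q`, they are homotopic rel
basepoint. -/
theorem stmt17 (n : ℕ) (Y : Type*) [TopologicalSpace Y] [SimplyConnectedSpace Y]
    (q : C(Fin n → Circle, Metric.sphere (0 : EuclideanSpace ℝ (Fin (n + 1))) 1))
    (hquot : Topology.IsQuotientMap q)
    (bS : Metric.sphere (0 : EuclideanSpace ℝ (Fin (n + 1))) 1)
    (hcollapse : ∀ x : Fin n → Circle, (∃ i, x i = 1) → q x = bS)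
    (hinj : ∀ x y : Fin n → Circle, ¬(∃ i, x i = 1) → ¬(∃ i, y i = 1) →
      q x = q y → x = y)
    (y₀ : Y)
    (f g : C(Metric.sphere (0 : EuclideanSpace ℝ (Fin (n + 1))) 1, Y))
    (hf : f bS = y₀) (hg : g bS = y₀)
    (h : ContinuousMap.HomotopicRel (f.comp q) (g.comp q)
      {fun _ => (1 : Circle)}) :
    ContinuousMap.HomotopicRel f g {bS} := by
  classical
  have hn : 0 < n := by
    rcases Nat.eq_zero_or_pos n with rfl | h0
    · exfalso
      obtain ⟨x, hx⟩ := hquot.surjective bS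
      obtain ⟨y, hy⟩ := hquot.surjective (-bS)
      have : x = y := Subsingleton.elim _ _
      rw [this, hy] at hx
      have h1 : -(bS : EuclideanSpace ℝ (Fin (0 + 1))) = bS := by
        exact_mod_cast congrArg Subtype.val hx
      have h2 : (bS : EuclideanSpace ℝ (Fin (0 + 1))) = 0 := by
        ext k
        have h4 := congrArg (fun z : EuclideanSpace ℝ (Fin (0 + 1)) => z k) h1
        simp only [PiLp.neg_apply] at h4
        simp only [PiLp.zero_apply]
        linarith
      have h3 := bS.2
      rw [h2] at h3
      simp at h3
    · exact h0
  let i₀ : Fin n := ⟨0, hn⟩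
  let E : (Fin n → unitInterval) → Fin n → Circle := fun t j => TorusCollapse.ee (t j)
  have cE : Continuous E :=
    continuous_pi fun j => TorusCollapse.ee_cont.comp (continuous_apply j)
  let p : (Fin n → unitInterval) → Metric.sphere (0 : EuclideanSpace ℝ (Fin (n + 1))) 1 :=
    fun t => q (E t)
  have cp : Continuous p := q.continuous.comp cE
  have sE : Function.Surjective E := fun z => by
    choose a ha using fun j => TorusCollapse.ee_surj (z j)
    exact ⟨a, funext ha⟩
  have sp : Function.Surjective p := hquot.surjective.comp sE
  have pEn : ∀ t j, TorusCollapse.En (t j) → p t = bS := fun t j hj =>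
    hcollapse _ ⟨j, TorusCollapse.ee_en hj⟩
  have pInj : ∀ t t', (∀ j, ¬ TorusCollapse.En (t j)) → (∀ j, ¬ TorusCollapse.En (t' j)) →
      p t = p t' → t = t' := by
    intro t t' h1 h2 h3
    have h4 : E t = E t' := hinj _ _
      (fun ⟨j, hj⟩ => h1 j (TorusCollapse.ee_one_en hj))
      (fun ⟨j, hj⟩ => h2 j (TorusCollapse.ee_one_en hj)) h3
    funext j
    rcases TorusCollapse.ee_inj (congrFun h4 j) with h5 | h5
    · exact h5
    · exact absurd h5.1 (h1 j)
  have cF : Continuous fun t => f (p t) := f.continuous.comp cp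
  have cG : Continuous fun t => g (p t) := g.continuous.comp cp
  have bF : TorusCollapse.Bd y₀ fun t => f (p t) := fun t j hj => by
    simp only [pEn t j hj, hf]
  have bG : TorusCollapse.Bd y₀ fun t => g (p t) := fun t j hj => by
    simp only [pEn t j hj, hg]
  obtain ⟨H⟩ := h
  have R0 : TorusCollapse.R (TorusCollapse.CS ∅ y₀) (fun t => f (p t)) (fun t => g (p t)) := by
    refine ⟨fun s t => H (s, E t), ?_, ?_, ?_, ?_⟩
    · exact H.continuous.comp (by fun_prop :
        Continuous fun a : unitInterval × (Fin n → unitInterval) => (a.1, E a.2))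
    · funext t
      exact H.apply_zero (E t)
    · funext t
      exact H.apply_one (E t)
    · intro s
      refine ⟨?_, ?_, ?_⟩
      · intro t j hj
        exact absurd hj (Set.notMem_empty j)
      · intro t t' hh
        have : E t = E t' := funext fun j => TorusCollapse.ee_eq' (hh j)
        simp only [this]
      · intro t hh
        have : E t = fun _ => 1 := funext fun j => TorusCollapse.ee_en (hh j)
        simp only [this]
        have h2 := H.eq_fst s (x := fun _ => (1 : Circle)) (Set.mem_singleton _)
        rw [h2]
        change f (q _) = y₀
        rw [hcollapse _ ⟨i₀, rfl⟩, hf]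
  have R1 := TorusCollapse.main cF cG bF bG R0
  have R2 : TorusCollapse.R (fun A => ∀ t, p t = bS → A t = y₀)
      (fun t => f (p t)) (fun t => g (p t)) := by
    by_cases hex : ∃ x₀ : Fin n → unitInterval, (∀ j, ¬ TorusCollapse.En (x₀ j)) ∧ p x₀ = bS
    · obtain ⟨x₀, hx₀, px₀⟩ := hex
      refine (TorusCollapse.extra cF cG bF bG x₀ hx₀ (by simp only [px₀, hf])
        (by simp only [px₀, hg]) R1).mono ?_
      rintro A ⟨hA, hA'⟩ t ht
      by_cases hb : ∃ j, TorusCollapse.En (t j)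
      · obtain ⟨j, hj⟩ := hb
        exact hA t j hj
      · push Not at hb
        rw [pInj t x₀ hb hx₀ (ht.trans px₀.symm), hA']
    · refine R1.mono ?_
      intro A hA t ht
      by_cases hb : ∃ j, TorusCollapse.En (t j)
      · obtain ⟨j, hj⟩ := hb
        exact hA t j hj
      · push Not at hb
        exact absurd ⟨t, hb, ht⟩ hex
  obtain ⟨Φ, cΦ, Φ0, Φ1, ΦP⟩ := R2
  let P : C(unitInterval × (Fin n → unitInterval),
      unitInterval × Metric.sphere (0 : EuclideanSpace ℝ (Fin (n + 1))) 1) :=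
    ⟨fun a => (a.1, p a.2), by fun_prop⟩
  have sP : Function.Surjective P := by
    rintro ⟨s, y⟩
    obtain ⟨t, ht⟩ := sp y
    exact ⟨(s, t), by simp [P, ht]⟩
  have hP : Topology.IsQuotientMap P := P.continuous.isClosedMap.isQuotientMap P.continuous sP
  have hfac : Function.FactorsThrough
      (⟨Function.uncurry Φ, cΦ⟩ : C(unitInterval × (Fin n → unitInterval), Y)) P := by
    rintro ⟨s, t⟩ ⟨s', t'⟩ hh
    obtain ⟨h1, h2⟩ := Prod.mk.inj hh
    dsimp only at h1 h2
    subst h1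
    change Φ s t = Φ s t'
    by_cases hb : p t = bS
    · rw [ΦP s t hb, ΦP s t' (h2 ▸ hb)]
    · rw [pInj t t' (fun j hj => hb (pEn t j hj)) (fun j hj => hb (h2.trans (pEn t' j hj))) h2]
  let Λ := hP.lift _ hfac
  have hΛ : ∀ s t, Λ (s, p t) = Φ s t := fun s t =>
    DFunLike.congr_fun (hP.lift_comp _ hfac) (s, t)
  refine ⟨{ toFun := Λ, continuous_toFun := Λ.continuous, map_zero_left := ?_,
            map_one_left := ?_, prop' := ?_ }⟩
  · intro y
    obtain ⟨t, rfl⟩ := sp y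
    exact (hΛ 0 t).trans (congrFun Φ0 t)
  · intro y
    obtain ⟨t, rfl⟩ := sp y
    exact (hΛ 1 t).trans (congrFun Φ1 t)
  · rintro s y hy
    rw [Set.mem_singleton_iff] at hy
    subst hy
    obtain ⟨t, ht⟩ := sp y
    have h1 := hΛ s t
    rw [ht, ΦP s t ht] at h1
    exact h1.trans hf.symm
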